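/- For every fixed d ≥ 2 and χ ≥ 1, there exists L₀ such that for all L ≥ L₀, the translation-symmetry maximally mixed invariant state ρ_T is not a mixture of uniform matrix product states of bond dimension χ: there is no finite family of probabilities p_α and unit vectors ψ_α ∈ uMPS(χ,d,L) with ρ_T = ∑_α p_α |ψ_α⟩⟨ψ_α|. -/

import Mathlib

open scoped BigOperators

noncomputable section

/-- Cyclic shift by one site: `(shift σ) i = σ (i - 1)`. -/
def shift (d L : ℕ) (σ : ZMod L → Fin d) : ZMod L → Fin d := fun i => σ (i - 1)

/-- The translation operator `T` on `H = (ℂ^d)^{⊗L}`. -/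
def Tmat (d L : ℕ) [NeZero L] : Matrix (ZMod L → Fin d) (ZMod L → Fin d) ℂ :=
  Matrix.of fun τ σ => if τ = shift d L σ then 1 else 0

/-- The projector `P_T = (1/L)·∑_{k=0}^{L−1} T^k`. -/
def Pmat (d L : ℕ) [NeZero L] : Matrix (ZMod L → Fin d) (ZMod L → Fin d) ℂ :=
  (L : ℂ)⁻¹ • ∑ k ∈ Finset.range L, Tmat d L ^ k

/-- The maximally mixed invariant state of translation, `ρ_T = P_T / Tr(P_T)`. -/
def rhoT (d L : ℕ) [NeZero L] : Matrix (ZMod L → Fin d) (ZMod L → Fin d) ℂ :=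
  ((Pmat d L).trace)⁻¹ • Pmat d L

/-- The set of uniform matrix product states of bond dimension `χ`. -/
def uMPS (χ d L : ℕ) : Set ((ZMod L → Fin d) → ℂ) :=
  {ψ | ∃ A : Fin d → Matrix (Fin χ) (Fin χ) ℂ,
    ∀ σ, ψ σ = Matrix.trace (((List.range L).map fun i => A (σ ((i : ℕ) : ZMod L))).prod)}

open MvPolynomial in
/-- The `χ × χ` matrix of indeterminates attached to the letter `a`. -/
def genericMatrix (d χ : ℕ) (a : Fin d) :
    Matrix (Fin χ) (Fin χ) (MvPolynomial (Fin d × Fin χ × Fin χ) ℂ) :=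
  Matrix.of fun i j => X (a, i, j)

open MvPolynomial in
theorem degreeOf_genericMatrix_prod_le {d χ : ℕ} (v : Fin d × Fin χ × Fin χ) (w : List (Fin d))
    (i j : Fin χ) :
    degreeOf v ((w.map (genericMatrix d χ)).prod i j) ≤ w.length := by
  induction w generalizing i j with
  | nil =>
    rw [List.map_nil, List.prod_nil, Matrix.one_apply]
    split_ifs <;> simp
  | cons a w ih =>
    rw [List.map_cons, List.prod_cons, Matrix.mul_apply]
    refine (degreeOf_sum_le _ _ _).trans (Finset.sup_le fun k _ => ?_)
    refine (degreeOf_mul_le _ _ _).trans ?_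
    have hX : degreeOf v (genericMatrix d χ a i k) ≤ 1 := by
      rw [genericMatrix, Matrix.of_apply, degreeOf_X]
      split_ifs <;> simp
    have := ih k j
    rw [List.length_cons]
    lia

open MvPolynomial in
theorem eval_trace_genericMatrix_prod {d χ : ℕ} (A : Fin d → Matrix (Fin χ) (Fin χ) ℂ)
    (w : List (Fin d)) :
    eval (fun v => A v.1 v.2.1 v.2.2) (w.map (genericMatrix d χ)).prod.trace
      = (w.map A).prod.trace := by
  rw [AddMonoidHom.map_trace, ← RingHom.mapMatrix_apply, map_list_prod, List.map_map]
  congr 3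
  funext a
  ext i j
  simp [genericMatrix]

/-- The exponents of the monomials whose degree in every variable is at most `L`. -/
def boundedExponents (d χ L : ℕ) : Finset ((Fin d × Fin χ × Fin χ) →₀ ℕ) :=
  Finset.Iic (Finsupp.equivFunOnFinite.symm fun _ => L)

theorem card_boundedExponents_le (d χ L : ℕ) :
    (boundedExponents d χ L).card ≤ (L + 1) ^ (d * (χ * χ)) := by
  rw [boundedExponents, Finsupp.card_Iic]
  simp only [Finsupp.equivFunOnFinite_symm_apply_apply, Nat.card_Iic, Finset.prod_const]
  refine Nat.pow_le_pow_right (Nat.succ_pos L) ((Finset.card_le_univ _).trans ?_)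
  simp

open MvPolynomial in
/-- All uniform matrix product states lie in the column space of one matrix, whose columns are
indexed by the exponents in `boundedExponents d χ L`. -/
theorem exists_matrix_mulVec_eq_of_mem_uMPS (χ d L : ℕ) :
    ∃ C : Matrix (ZMod L → Fin d) (boundedExponents d χ L) ℂ,
      ∀ ψ ∈ uMPS χ d L, ∃ x, ψ = C.mulVec x := by
  let Q (σ : ZMod L → Fin d) : MvPolynomial (Fin d × Fin χ × Fin χ) ℂ :=
    (((List.range L).map fun i => σ ((i : ℕ) : ZMod L)).map (genericMatrix d χ)).prod.trace
  have hQ (σ) : (Q σ).support ⊆ boundedExponents d χ L := by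
    intro m hm
    rw [boundedExponents, Finset.mem_Iic]
    intro v
    refine (monomial_le_degreeOf v hm).trans ((degreeOf_sum_le _ _ _).trans
      (Finset.sup_le fun i _ => ?_))
    refine (degreeOf_genericMatrix_prod_le v _ i i).trans ?_
    simp
  refine ⟨Matrix.of fun σ m => coeff m.1 (Q σ), ?_⟩
  rintro ψ ⟨A, hA⟩
  refine ⟨fun m => ∏ v, A v.1 v.2.1 v.2.2 ^ m.1 v, funext fun σ => ?_⟩
  have h := eval_trace_genericMatrix_prod A ((List.range L).map fun i => σ ((i : ℕ) : ZMod L))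
  rw [List.map_map (g := A)] at h
  refine (hA σ).trans (h.symm.trans ?_)
  change eval _ (Q σ) = _
  rw [eval_eq', Finset.sum_subset (hQ σ) fun m _ hm => by rw [notMem_support_iff.mp hm, zero_mul],
    ← Finset.sum_coe_sort]
  rfl

theorem Matrix.trace_eq_rank_of_isIdempotentElem {n K : Type*} [Fintype n] [DecidableEq n]
    [Field K] {P : Matrix n n K} (hP : IsIdempotentElem P) : P.trace = P.rank := by
  have h : LinearMap.IsProj (LinearMap.range P.toLin') P.toLin' := by
    refine ⟨fun x => LinearMap.mem_range_self _ x, ?_⟩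
    rintro _ ⟨x, rfl⟩
    rw [← LinearMap.comp_apply, ← Matrix.toLin'_mul, hP.eq]
  rw [← Matrix.trace_toLin'_eq, h.trace]
  rfl

theorem shift_iterate_apply (d L k : ℕ) (σ : ZMod L → Fin d) (i : ZMod L) :
    (shift d L)^[k] σ i = σ (i - k) := by
  induction k generalizing i with
  | zero => simp
  | succ k ih =>
    rw [Function.iterate_succ_apply', shift, ih]
    push_cast
    congr 1
    ring

theorem Tmat_pow_apply (d L : ℕ) [NeZero L] (k : ℕ) (τ σ : ZMod L → Fin d) :
    (Tmat d L ^ k) τ σ = if τ = (shift d L)^[k] σ then 1 else 0 := by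
  induction k generalizing σ with
  | zero => rw [pow_zero, Matrix.one_apply]; rfl
  | succ k ih =>
    have hT (υ) : Tmat d L υ σ = if υ = shift d L σ then 1 else 0 := rfl
    rw [pow_succ, Matrix.mul_apply]
    simp only [hT, mul_ite, mul_one, mul_zero, Finset.sum_ite_eq', Finset.mem_univ, if_true, ih]
    rfl

theorem Tmat_pow_self (d L : ℕ) [NeZero L] : Tmat d L ^ L = 1 := by
  ext τ σ
  have h : (shift d L)^[L] σ = σ := funext fun i => by simp [shift_iterate_apply]
  rw [Tmat_pow_apply, h, Matrix.one_apply]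

theorem isIdempotentElem_Pmat (d L : ℕ) [NeZero L] : IsIdempotentElem (Pmat d L) := by
  have hT : Tmat d L * ∑ k ∈ Finset.range L, Tmat d L ^ k
      = ∑ k ∈ Finset.range L, Tmat d L ^ k := by
    have := mul_geom_sum (Tmat d L) L
    rwa [Tmat_pow_self, sub_self, sub_mul, one_mul, sub_eq_zero] at this
  have hTk (k : ℕ) : Tmat d L ^ k * ∑ j ∈ Finset.range L, Tmat d L ^ j
      = ∑ j ∈ Finset.range L, Tmat d L ^ j := by
    induction k with
    | zero => simp
    | succ k ih => rw [pow_succ, mul_assoc, hT, ih]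
  have hL : (L : ℂ) ≠ 0 := Nat.cast_ne_zero.mpr (NeZero.ne L)
  rw [IsIdempotentElem, Pmat, smul_mul_smul_comm, Finset.sum_mul]
  simp only [hTk, Finset.sum_const, Finset.card_range]
  rw [← Nat.cast_smul_eq_nsmul ℂ, smul_smul, mul_assoc, inv_mul_cancel₀ hL, mul_one]

theorem pow_le_mul_rank_Pmat (d L : ℕ) [NeZero L] : d ^ L ≤ L * (Pmat d L).rank := by
  have hL : (L : ℂ) ≠ 0 := Nat.cast_ne_zero.mpr (NeZero.ne L)
  have htr (k : ℕ) : (Tmat d L ^ k).trace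
      = ((Finset.univ.filter fun σ => σ = (shift d L)^[k] σ).card : ℂ) := by
    simp [Matrix.trace, Tmat_pow_apply]
  have h : L * (Pmat d L).rank = ∑ k ∈ Finset.range L,
      (Finset.univ.filter fun σ => σ = (shift d L)^[k] σ).card := by
    have : (L : ℂ) * (Pmat d L).rank = ∑ k ∈ Finset.range L, (Tmat d L ^ k).trace := by
      rw [← Matrix.trace_eq_rank_of_isIdempotentElem (isIdempotentElem_Pmat d L), Pmat,
        Matrix.trace_smul, Matrix.trace_sum, smul_eq_mul, mul_inv_cancel_left₀ hL]
    simp only [htr] at this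
    exact_mod_cast this
  rw [h]
  calc d ^ L = (Finset.univ.filter fun σ => σ = (shift d L)^[0] σ).card := by simp [ZMod.card]
    _ ≤ _ := Finset.single_le_sum
      (f := fun k => (Finset.univ.filter fun σ => σ = (shift d L)^[k] σ).card)
      (fun _ _ => Nat.zero_le _) (Finset.mem_range.mpr (NeZero.pos L))

theorem exists_forall_mul_succ_pow_lt_two_pow (N : ℕ) :
    ∃ L₀ : ℕ, ∀ L, L₀ ≤ L → L * (L + 1) ^ N < 2 ^ L := by
  have h := (tendsto_pow_const_div_const_pow_of_one_lt (N + 1) (one_lt_two (α := ℝ))).eventually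
    (gt_mem_nhds (show (0 : ℝ) < 1 / 2 by norm_num))
  obtain ⟨L₀, hL₀⟩ := Filter.eventually_atTop.mp h
  refine ⟨L₀, fun L hL => ?_⟩
  have h1 := hL₀ (L + 1) (by lia)
  rw [div_lt_iff₀ (by positivity), pow_succ 2 L] at h1
  have h2 : (L + 1) ^ (N + 1) < 2 ^ L := by
    have : ((L + 1 : ℕ) : ℝ) ^ (N + 1) < 2 ^ L := by linarith
    exact_mod_cast this
  refine lt_of_le_of_lt ?_ h2
  rw [pow_succ, mul_comm]
  exact Nat.mul_le_mul_left _ (Nat.le_succ L)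

/-- for every fixed `d ≥ 2` and `χ ≥ 1` there is `L₀` such that for all
`L ≥ L₀`, the MMIS `ρ_T` is not a finite mixture of (unit-norm) uniform matrix product
states of bond dimension `χ`. -/
theorem stmt12 (d χ : ℕ) (hd : 2 ≤ d) (hχ : 1 ≤ χ) :
    ∃ L₀ : ℕ, ∀ (L : ℕ) [NeZero L], L₀ ≤ L →
      ¬ ∃ (n : ℕ) (p : Fin n → ℝ) (ψ : Fin n → (ZMod L → Fin d) → ℂ),
        (∀ α, 0 ≤ p α) ∧ (∑ α, p α = 1) ∧
        (∀ α, ψ α ∈ uMPS χ d L) ∧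
        (∀ α, ∑ σ, Complex.normSq (ψ α σ) = 1) ∧
        rhoT d L = ∑ α, (p α : ℂ) • Matrix.vecMulVec (ψ α) (star (ψ α)) := by
  obtain ⟨L₀, hL₀⟩ := exists_forall_mul_succ_pow_lt_two_pow (d * (χ * χ))
  refine ⟨L₀, fun L _ hL => ?_⟩
  rintro ⟨n, p, ψ, -, -, hψ, -, hρ⟩
  obtain ⟨C, hC⟩ := exists_matrix_mulVec_eq_of_mem_uMPS χ d L
  choose x hx using fun α => hC (ψ α) (hψ α)
  have hrank := pow_le_mul_rank_Pmat d L
  have hrank_pos : (Pmat d L).rank ≠ 0 := by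
    intro h
    rw [h, mul_zero] at hrank
    exact absurd hrank (Nat.not_le.mpr (Nat.pow_pos (by lia)))
  have htrace : (Pmat d L).trace ≠ 0 := by
    rw [Matrix.trace_eq_rank_of_isIdempotentElem (isIdempotentElem_Pmat d L)]
    exact_mod_cast hrank_pos
  have hP : Pmat d L = C * ((Pmat d L).trace •
      ∑ α, (p α : ℂ) • Matrix.vecMulVec (x α) (star (ψ α))) := by
    rw [Matrix.mul_smul, Matrix.mul_sum]
    simp only [Matrix.mul_smul, Matrix.mul_vecMulVec, ← hx]
    rw [← hρ, rhoT, smul_inv_smul₀ htrace]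
  have hle : (Pmat d L).rank ≤ (L + 1) ^ (d * (χ * χ)) := by
    rw [hP]
    refine (Matrix.rank_mul_le_left _ _).trans (C.rank_le_card_width.trans ?_)
    rw [Fintype.card_coe]
    exact card_boundedExponents_le d χ L
  have := hL₀ L hL
  have := Nat.pow_le_pow_left hd L
  have := Nat.mul_le_mul_left L hle
  lia
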